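/- In particular, for d = 3 (the qutrit case), the SWAP permutation of (ZMod 3) × (ZMod 3), sending (m, n) to (n, m), does not lie in the subgroup of the symmetric group on (ZMod 3) × (ZMod 3) generated by σ_CNOT1 : (m, n) ↦ (m, n + m) and σ_CNOT2 : (m, n) ↦ (m + n, n); hence a swap of two qutrits is not possible using a composition of CNOT gates alone. -/

import Mathlib

/-- The CNOT1 gate on a pair of qutrits: the permutation of basis labels
sending `(m, n)` to `(m, n + m)`, addition modulo `3`. -/
def cnot1 : Equiv.Perm (ZMod 3 × ZMod 3) where
  toFun p := (p.1, p.2 + p.1)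
  invFun p := (p.1, p.2 - p.1)
  left_inv p := by simp
  right_inv p := by simp

/-- The CNOT2 gate on a pair of qutrits: the permutation of basis labels
sending `(m, n)` to `(m + n, n)`, addition modulo `3`. -/
def cnot2 : Equiv.Perm (ZMod 3 × ZMod 3) where
  toFun p := (p.1 + p.2, p.2)
  invFun p := (p.1 - p.2, p.2)
  left_inv p := by simp
  right_inv p := by simp

theorem sign_eq_one_of_pow_three_eq_one {α : Type*} [DecidableEq α] [Fintype α]
    {σ : Equiv.Perm α} (h : σ ^ 3 = 1) : Equiv.Perm.sign σ = 1 := by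
  have h' : Equiv.Perm.sign σ ^ 3 = 1 := by rw [← map_pow, h, map_one]
  rcases Int.units_eq_one_or (Equiv.Perm.sign σ) with h₁ | h₁
  · exact h₁
  · rw [h₁] at h'
    exact absurd h' (by decide)

theorem sign_qutrit_swap :
    Equiv.Perm.sign (Equiv.prodComm (ZMod 3) (ZMod 3) : Equiv.Perm (ZMod 3 × ZMod 3)) = -1 := by
  have h : (Equiv.prodComm (ZMod 3) (ZMod 3) : Equiv.Perm (ZMod 3 × ZMod 3)) =
      Equiv.swap (0, 1) (1, 0) * Equiv.swap (0, 2) (2, 0) * Equiv.swap (1, 2) (2, 1) := by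
    decide
  rw [h, map_mul, map_mul, Equiv.Perm.sign_swap (by decide), Equiv.Perm.sign_swap (by decide),
    Equiv.Perm.sign_swap (by decide)]
  decide

theorem qutrit_swap_not_in_closure_cnot :
    (Equiv.prodComm (ZMod 3) (ZMod 3) : Equiv.Perm (ZMod 3 × ZMod 3)) ∉
      Subgroup.closure {cnot1, cnot2} := by
  intro hmem
  have hle : Subgroup.closure {cnot1, cnot2} ≤ (Equiv.Perm.sign (α := ZMod 3 × ZMod 3)).ker := by
    rw [Subgroup.closure_le]
    rintro σ (rfl | rfl)
    · exact sign_eq_one_of_pow_three_eq_one (by decide)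
    · exact sign_eq_one_of_pow_three_eq_one (by decide)
  have h : Equiv.Perm.sign
      (Equiv.prodComm (ZMod 3) (ZMod 3) : Equiv.Perm (ZMod 3 × ZMod 3)) = 1 := hle hmem
  rw [sign_qutrit_swap] at h
  exact absurd h (by decide)
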